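/- arXiv:1612.04050 — 6 statements merged into one kernel-verified Lean document; each statement's English description precedes it below -/
import Mathlib

section
/- Consider N ≥ 3 agents on a ring with spacings s_i (indices taken modulo N) evolving according to the spacing dynamics of the microscopic follow-the-leader model with reaction time: for all t ≥ 0 and all i, s_i'(t) = W( s_{i+1}(t) − τ[W(s_{i+2}(t)) − W(s_{i+1}(t))] ) − W( s_i(t) − τ[W(s_{i+1}(t)) − W(s_i(t))] ). Assume W : ℝ → ℝ is Lipschitz continuous, non-decreasing, satisfies 0 ≤ W(s) ≤ V₀ for all s and W(s) = 0 whenever s ≤ ℓ, where ℓ > 0 and V₀ > 0, and assume τ ≥ 0. If s_i(0) ≥ ℓ for every i, then s_i(t) ≥ ℓ for every i and every t ≥ 0 (minimum principle: the model is collision-free). -/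
/-- Minimum principle (collision-freeness) for the spacing dynamics of the
microscopic follow-the-leader model with reaction time `τ ≥ 0` on a ring of
`N ≥ 3` agents. -/
theorem stmt0 (N : ℕ) (hN : 3 ≤ N) (W : ℝ → ℝ) (K : NNReal)
    (hLip : LipschitzWith K W) (hMono : Monotone W)
    (V₀ ℓ τ : ℝ) (hV₀ : 0 < V₀) (hℓ : 0 < ℓ) (hτ : 0 ≤ τ)
    (hWpos : ∀ x : ℝ, 0 ≤ W x) (hWbound : ∀ x : ℝ, W x ≤ V₀)
    (hWzero : ∀ x : ℝ, x ≤ ℓ → W x = 0)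
    (s : ZMod N → ℝ → ℝ)
    (hdyn : ∀ i : ZMod N, ∀ t : ℝ, 0 ≤ t →
      HasDerivAt (s i)
        (W (s (i + 1) t - τ * (W (s (i + 2) t) - W (s (i + 1) t)))
          - W (s i t - τ * (W (s (i + 1) t) - W (s i t)))) t)
    (hinit : ∀ i : ZMod N, ℓ ≤ s i 0) :
    ∀ i : ZMod N, ∀ t : ℝ, 0 ≤ t → ℓ ≤ s i t := by
  intro i t ht
  -- below the level `ℓ` the derivative is non-negative
  have key : ∀ x : ℝ, 0 ≤ x → s i x ≤ ℓ →
      0 ≤ W (s (i + 1) x - τ * (W (s (i + 2) x) - W (s (i + 1) x)))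
          - W (s i x - τ * (W (s (i + 1) x) - W (s i x))) := by
    intro x _ hs
    have h0 : W (s i x) = 0 := hWzero _ hs
    have h2 : 0 ≤ τ * W (s (i + 1) x) := mul_nonneg hτ (hWpos _)
    have h1 : W (s i x - τ * (W (s (i + 1) x) - W (s i x))) = 0 := by
      apply hWzero
      rw [h0, sub_zero]
      linarith
    rw [h1, sub_zero]
    exact hWpos _
  have main : ∀ ε : ℝ, 0 < ε → -(s i t) ≤ -ℓ + ε * t := by
    intro ε hε
    refine image_le_of_deriv_right_lt_deriv_boundary (a := 0) (b := t)
      (f := fun x => -(s i x)) (B := fun x => -ℓ + ε * x) (B' := fun _ => ε)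
      (f' := fun x => -(W (s (i + 1) x - τ * (W (s (i + 2) x) - W (s (i + 1) x)))
          - W (s i x - τ * (W (s (i + 1) x) - W (s i x))))) ?_ ?_ ?_ ?_ ?_ ⟨ht, le_rfl⟩
    · intro x hx
      exact (hdyn i x hx.1).continuousAt.neg.continuousWithinAt
    · intro x hx
      exact (hdyn i x hx.1).neg.hasDerivWithinAt
    · have := hinit i
      simpa using this
    · intro x
      simpa using ((hasDerivAt_id x).const_mul ε).const_add (-ℓ)
    · intro x hx hxe
      have hxe' : -(s i x) = -ℓ + ε * x := hxe
      have : 0 ≤ ε * x := mul_nonneg hε.le hx.1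
      have := key x hx.1 (by linarith)
      show -(_ : ℝ) < ε
      linarith
  have h3 : -(s i t) ≤ -ℓ := by
    apply le_of_forall_pos_le_add
    intro δ hδ
    have h := main (δ / (t + 1)) (by positivity)
    have : δ / (t + 1) * t ≤ δ := by
      rw [div_mul_eq_mul_div, div_le_iff₀ (by positivity)]
      nlinarith
    linarith
  linarith
end

section
/- Let w > 0 and τ ∈ ℝ satisfy |τ|·w < 1/2. Then for every θ ∈ (0, 2π), Re( w·((e^{iθ} − 1) − τ·w·(e^{iθ} − 1)²) ) < 0. (Equivalently, using Re(w((e^{iθ}−1) − τw(e^{iθ}−1)²)) = w(cos θ − 1)(1 − 2τw cos θ), all non-trivial eigenvalues of the linearized microscopic model have negative real part, so homogeneous configurations are linearly stable.) -/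
/-- Linear stability of homogeneous configurations of the microscopic model:
if `|τ|·w < 1/2` with `w = W'(s_e) > 0`, then all non-trivial eigenvalues
`w((e^{iθ} − 1) − τw(e^{iθ} − 1)²)`, `θ ∈ (0, 2π)`, have negative real part. -/
theorem stmt1 (w τ : ℝ) (hw : 0 < w) (h : |τ| * w < 1 / 2) :
    ∀ θ ∈ Set.Ioo (0 : ℝ) (2 * Real.pi),
      ((w : ℂ) * ((Complex.exp (θ * Complex.I) - 1)
        - (τ : ℂ) * (w : ℂ) * (Complex.exp (θ * Complex.I) - 1) ^ 2)).re < 0 := by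
  rintro θ ⟨h0, h1⟩
  have hc : Real.cos θ < 1 := by
    refine lt_of_le_of_ne (Real.cos_le_one θ) fun he => ?_
    have := (Real.cos_eq_one_iff_of_lt_of_lt (by linarith) h1).1 he
    linarith
  have hexp : Complex.exp (θ * Complex.I) = (⟨Real.cos θ, Real.sin θ⟩ : ℂ) := by
    apply Complex.ext
    · exact Complex.exp_ofReal_mul_I_re θ
    · exact Complex.exp_ofReal_mul_I_im θ
  have hre : ((w : ℂ) * ((Complex.exp (θ * Complex.I) - 1)
        - (τ : ℂ) * (w : ℂ) * (Complex.exp (θ * Complex.I) - 1) ^ 2)).re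
      = w * ((Real.cos θ - 1) * (1 - 2 * (τ * w * Real.cos θ))) := by
    rw [hexp]
    simp [pow_two]
    left
    linear_combination (τ * w) * Real.sin_sq_add_cos_sq θ
  have hb : |τ * w * Real.cos θ| < 1 / 2 := by
    rw [abs_mul, abs_mul, abs_of_pos hw]
    have : 0 ≤ |τ| * w := by positivity
    exact lt_of_le_of_lt (mul_le_of_le_one_right this (Real.abs_cos_le_one θ)) h
  rw [hre]
  have := (abs_lt.1 hb).2
  exact mul_neg_of_pos_of_neg hw (mul_neg_of_neg_of_pos (by linarith) (by linarith))
end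

section
/- Let w > 0 and τ ∈ ℝ satisfy τ·w > 1/2. Then there exists θ₀ ∈ (0, π] such that for every θ ∈ (0, θ₀), Re( w·((e^{iθ} − 1) − τ·w·(e^{iθ} − 1)²) ) > 0. (Hence for all sufficiently large ring sizes N, the linearized microscopic model has an eigenvalue with positive real part and homogeneous configurations are linearly unstable.) -/
/-- Linear instability of homogeneous configurations of the microscopic model:
if `τ·w > 1/2` with `w = W'(s_e) > 0`, then there is `θ₀ ∈ (0, π]` such that
the eigenvalues `w((e^{iθ} − 1) − τw(e^{iθ} − 1)²)` have positive real part
for every `θ ∈ (0, θ₀)`. -/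
theorem stmt2 (w τ : ℝ) (hw : 0 < w) (h : 1 / 2 < τ * w) :
    ∃ θ₀ ∈ Set.Ioc (0 : ℝ) Real.pi,
      ∀ θ ∈ Set.Ioo (0 : ℝ) θ₀,
        0 < ((w : ℂ) * ((Complex.exp (θ * Complex.I) - 1)
          - (τ : ℂ) * (w : ℂ) * (Complex.exp (θ * Complex.I) - 1) ^ 2)).re := by
  have ha : 0 < 2 * (τ * w) := by linarith
  have h1 : 1 / (2 * (τ * w)) < 1 := by
    rw [div_lt_one ha]; linarith
  have h0 : 0 < 1 / (2 * (τ * w)) := by positivity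
  refine ⟨Real.arccos (1 / (2 * (τ * w))),
    ⟨Real.arccos_pos.2 h1, Real.arccos_le_pi _⟩, ?_⟩
  rintro θ ⟨hθ, hθ'⟩
  have hpi := Real.arccos_le_pi (1 / (2 * (τ * w)))
  have hc := Real.cos_lt_cos_of_nonneg_of_le_pi hθ.le hpi hθ'
  rw [Real.cos_arccos (by linarith) h1.le, div_lt_iff₀ ha] at hc
  have hc1 : Real.cos θ < 1 := by
    have := Real.cos_lt_cos_of_nonneg_of_le_pi le_rfl (hθ'.le.trans hpi) hθ
    rwa [Real.cos_zero] at this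
  have key : ((w : ℂ) * ((Complex.exp (θ * Complex.I) - 1)
          - (τ : ℂ) * (w : ℂ) * (Complex.exp (θ * Complex.I) - 1) ^ 2)).re
      = w * ((1 - Real.cos θ) * (Real.cos θ * (2 * (τ * w)) - 1)) := by
    simp only [pow_two, Complex.mul_re, Complex.mul_im, Complex.sub_re, Complex.sub_im,
      Complex.exp_ofReal_mul_I_re, Complex.exp_ofReal_mul_I_im, Complex.ofReal_re,
      Complex.ofReal_im, Complex.one_re, Complex.one_im]
    linear_combination (τ * w ^ 2) * Real.sin_sq_add_cos_sq θ
  rw [key]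
  exact mul_pos hw (mul_pos (by linarith) (by linarith))
end

section
/- Let ρ_e > 0, let V be differentiable at ρ_e with ρ_e·V'(ρ_e) ≠ 0, let τ ∈ ℝ, and set β₀ = −V(ρ_e) − ρ_e V'(ρ_e) and γ₀ = −τ(ρ_e V'(ρ_e))². Then the following are equivalent: (i) for every real l ≠ 0 and every λ ∈ ℂ, if the complex-valued function u(t,x) = exp(λ t − i l x) on ℝ² satisfies ∂_t u = β₀ ∂_x u + γ₀ ∂²_{xx} u everywhere, then Re λ < 0; (ii) τ < 0. In other words, homogeneous configurations ρ(x,t) = ρ_e are linearly stable for the continuous macroscopic model if and only if τ < 0 (a negative τ being an anticipation time). -/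
theorem aux_t (a b : ℂ) (t : ℝ) :
    deriv (fun t' : ℝ => Complex.exp (a * (t' : ℂ) - b)) t = a * Complex.exp (a * (t : ℂ) - b) := by
  have h : HasDerivAt (fun t' : ℝ => Complex.exp (a * (t' : ℂ) - b))
      (Complex.exp (a * (t : ℂ) - b) * (a * 1)) t :=
    (((Complex.ofRealCLM.hasDerivAt (x := t)).const_mul a).sub_const b).cexp
  rw [h.deriv]; ring

theorem aux_x (a b : ℂ) :
    deriv (fun x' : ℝ => Complex.exp (a - b * (x' : ℂ)))
      = fun x : ℝ => -b * Complex.exp (a - b * (x : ℂ)) := by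
  funext x
  have h : HasDerivAt (fun x' : ℝ => Complex.exp (a - b * (x' : ℂ)))
      (Complex.exp (a - b * (x : ℂ)) * (-(b * 1))) x :=
    (((Complex.ofRealCLM.hasDerivAt (x := x)).const_mul b).const_sub a).cexp
  rw [h.deriv]; ring

theorem aux_xx (a b : ℂ) (x : ℝ) :
    deriv (deriv (fun x' : ℝ => Complex.exp (a - b * (x' : ℂ)))) x
      = b ^ 2 * Complex.exp (a - b * (x : ℂ)) := by
  rw [aux_x, deriv_const_mul_field, aux_x]; ring

/-- Homogeneous configurations `ρ ≡ ρ_e` are linearly stable for the continuous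
macroscopic convection–diffusion model (every plane-wave perturbation
`e^{λt − ilx}`, `l ≠ 0`, solving `ε_t = β₀ ε_x + γ₀ ε_{xx}` has `Re λ < 0`)
if and only if `τ < 0`. -/
theorem stmt3 (V : ℝ → ℝ) (ρe v τ : ℝ) (hρe : 0 < ρe)
    (hV : HasDerivAt V v ρe) (hne : ρe * v ≠ 0)
    (β₀ γ₀ : ℝ) (hβ₀ : β₀ = -V ρe - ρe * v) (hγ₀ : γ₀ = -τ * (ρe * v) ^ 2) :
    (∀ l : ℝ, l ≠ 0 → ∀ lam : ℂ,
        (∀ t x : ℝ,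
          deriv (fun t' : ℝ => Complex.exp (lam * (t' : ℂ) - Complex.I * (l : ℂ) * (x : ℂ))) t
            = (β₀ : ℂ) * deriv (fun x' : ℝ =>
                Complex.exp (lam * (t : ℂ) - Complex.I * (l : ℂ) * (x' : ℂ))) x
              + (γ₀ : ℂ) * deriv (deriv (fun x' : ℝ =>
                Complex.exp (lam * (t : ℂ) - Complex.I * (l : ℂ) * (x' : ℂ)))) x)
        → lam.re < 0)
      ↔ τ < 0 := by
  have hpos : 0 < (ρe * v) ^ 2 := by positivity
  simp only [aux_t, aux_xx]
  simp only [aux_x]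
  constructor
  · intro h
    have h1 := h 1 one_ne_zero (-Complex.I * β₀ - γ₀) (by
      intro t x
      push_cast
      linear_combination (-γ₀ * Complex.exp ((-Complex.I * β₀ - γ₀) * t - Complex.I * 1 * x)) *
        Complex.I_sq)
    have h2 : -γ₀ < 0 := by simpa using h1
    rw [hγ₀] at h2
    by_contra hτ
    push Not at hτ
    nlinarith [mul_nonneg hτ hpos.le]
  · intro hτ l hl lam h
    have h0 := h 0 0
    simp only [Complex.ofReal_zero, mul_zero, sub_zero, Complex.exp_zero, mul_one] at h0
    have h2 : lam = -Complex.I * (β₀ * l : ℝ) - (γ₀ * l ^ 2 : ℝ) := by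
      push_cast
      linear_combination h0 + γ₀ * l ^ 2 * Complex.I_sq
    have h3 : lam.re = -(γ₀ * l ^ 2) := by
      rw [h2, Complex.sub_re, Complex.ofReal_re, Complex.re_mul_ofReal]
      simp
    have hl2 : 0 < l ^ 2 := by positivity
    rw [h3, hγ₀]
    nlinarith [mul_pos (mul_pos (neg_pos.mpr hτ) hpos) hl2]
end

section
/- Let T, Δx, Δt, ℓ > 0, τ ∈ ℝ, ρ_e > 0, and define F₃ on a neighborhood of (ρ_e, ρ_e, ρ_e, ρ_e) in (0,∞)⁴ by F₃(a, b, c, d) = a + (Δt·ℓ/(TΔx))( b/(1 − (τ/(TΔx))(1/c − 1/b)) − a/(1 − (τ/(TΔx))(1/b − 1/a)) ) (here a, b, c, d stand for ρ_i, ρ_{i+1}, ρ_{i+2}, ρ_{i−1}). Then F₃ is differentiable at (ρ_e, ρ_e, ρ_e, ρ_e) and its partial derivatives there are ∂F₃/∂a = 1 − A(1 + B), ∂F₃/∂b = A(1 + 2B), ∂F₃/∂c = −AB, ∂F₃/∂d = 0, where A = Δtℓ/(TΔx) and B = τ/(TΔxρ_e). In particular F₃ has the same linearization at equilibrium as the Godunov/Godunov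 scheme F₂, hence the same linear stability conditions. -/
/-- The simple Godunov update map `F₃` is differentiable at the equilibrium
point `(ρ_e, ρ_e, ρ_e, ρ_e)` with partial derivatives
`(1 − A(1+B), A(1+2B), −AB, 0)` where `A = Δtℓ/(TΔx)` and `B = τ/(TΔxρ_e)`:
the same linearization (hence the same linear stability conditions) as the
Godunov/Godunov scheme `F₂`. -/
theorem stmt16 (T Δx Δt ℓ τ ρe : ℝ)
    (hT : 0 < T) (hΔx : 0 < Δx) (hΔt : 0 < Δt) (hℓ : 0 < ℓ) (hρe : 0 < ρe)
    (A B : ℝ) (hA : A = Δt * ℓ / (T * Δx)) (hB : B = τ / (T * Δx * ρe)) :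
    HasFDerivAt
      (fun p : Fin 4 → ℝ =>
        p 0 + Δt * ℓ / (T * Δx) *
          (p 1 / (1 - τ / (T * Δx) * (1 / p 2 - 1 / p 1))
            - p 0 / (1 - τ / (T * Δx) * (1 / p 1 - 1 / p 0))))
      ((1 - A * (1 + B)) • (ContinuousLinearMap.proj 0 : (Fin 4 → ℝ) →L[ℝ] ℝ)
        + (A * (1 + 2 * B)) • (ContinuousLinearMap.proj 1 : (Fin 4 → ℝ) →L[ℝ] ℝ)
        + (-(A * B)) • (ContinuousLinearMap.proj 2 : (Fin 4 → ℝ) →L[ℝ] ℝ)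
        + (0 : ℝ) • (ContinuousLinearMap.proj 3 : (Fin 4 → ℝ) →L[ℝ] ℝ))
      (fun _ => ρe) := by
  have hr : ρe ≠ 0 := hρe.ne'
  have hT' : T ≠ 0 := hT.ne'
  have hx' : Δx ≠ 0 := hΔx.ne'
  have hp : ∀ i : Fin 4, HasFDerivAt (fun p : Fin 4 → ℝ => p i)
      (ContinuousLinearMap.proj i : (Fin 4 → ℝ) →L[ℝ] ℝ) (fun _ => ρe) :=
    fun i => hasFDerivAt_apply i _
  have hinv : ∀ i : Fin 4, HasFDerivAt (fun p : Fin 4 → ℝ => 1 / p i)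
      ((-(ρe ^ 2)⁻¹) • (ContinuousLinearMap.proj i : (Fin 4 → ℝ) →L[ℝ] ℝ)) (fun _ => ρe) := by
    intro i
    have h := (hasDerivAt_inv hr).comp_hasFDerivAt_of_eq (fun _ : Fin 4 => ρe) (hp i) rfl
    simp only [one_div]
    exact h
  have key : ∀ i j : Fin 4, HasFDerivAt
      (fun p : Fin 4 → ℝ => p i / (1 - τ / (T * Δx) * (1 / p j - 1 / p i)))
      ((1 + B) • (ContinuousLinearMap.proj i : (Fin 4 → ℝ) →L[ℝ] ℝ)
        + (-B) • (ContinuousLinearMap.proj j : (Fin 4 → ℝ) →L[ℝ] ℝ)) (fun _ => ρe) := by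
    intro i j
    have hd := (((hinv j).fun_sub (hinv i)).const_mul (τ / (T * Δx))).const_sub 1
    have h1 : (1 - τ / (T * Δx) * (1 / ρe - 1 / ρe)) = 1 := by ring
    have hi := (hasDerivAt_inv (one_ne_zero (α := ℝ))).comp_hasFDerivAt_of_eq
      (fun _ : Fin 4 => ρe) hd h1.symm
    have h := (hp i).fun_mul hi
    simp only [div_eq_mul_inv (_ : ℝ) (1 - _)]
    refine h.congr_fderiv ?_
    ext v
    simp [hB]
    field_simp
    ring
  refine ((hp 0).fun_add (((key 1 2).fun_sub (key 0 1)).const_mul (Δt * ℓ / (T * Δx)))).congr_fderiv ?_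
  rw [← hA]
  ext v
  simp
  ring
end

section
/- Let V₀ > 0, τ ≥ 0, and let V : (0, ∞) → ℝ be non-increasing with 0 ≤ V(k) ≤ V₀ for all k > 0. Let ρ > 0 satisfy 1 − τρ(V₀ − V(ρ)) > 0. Then for every ρ' > 0, the modified speed V( ρ/(1 − τρ(V(ρ') − V(ρ))) ) is well defined and satisfies V⁻(ρ) ≤ V( ρ/(1 − τρ(V(ρ') − V(ρ))) ) ≤ V⁺(ρ), where V⁺(ρ) = V( ρ/(1 + τρV(ρ)) ) and V⁻(ρ) = V( ρ/(1 − τρ(V₀ − V(ρ))) ). (These are the upper and lower bounds of the scattered fundamental diagram of the macroscopic model.) -/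
/-- Bounds of the scattered fundamental diagram: for a non-increasing speed
function `V` with `0 ≤ V ≤ V₀` on `(0, ∞)`, reaction time `τ ≥ 0`, and `ρ > 0`
with `1 − τρ(V₀ − V(ρ)) > 0`, the modified speed
`V(ρ/(1 − τρ(V(ρ') − V(ρ))))` is well defined for every `ρ' > 0` and lies
between `V⁻(ρ) = V(ρ/(1 − τρ(V₀ − V(ρ))))` and `V⁺(ρ) = V(ρ/(1 + τρV(ρ)))`. -/
theorem stmt18 (V₀ τ : ℝ) (hV₀ : 0 < V₀) (hτ : 0 ≤ τ)
    (V : ℝ → ℝ) (hmono : ∀ a b : ℝ, 0 < a → a ≤ b → V b ≤ V a)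
    (hbd : ∀ k : ℝ, 0 < k → 0 ≤ V k ∧ V k ≤ V₀)
    (ρ : ℝ) (hρ : 0 < ρ) (hden : 0 < 1 - τ * ρ * (V₀ - V ρ)) :
    ∀ ρ' : ℝ, 0 < ρ' →
      0 < ρ / (1 - τ * ρ * (V ρ' - V ρ))
        ∧ V (ρ / (1 - τ * ρ * (V₀ - V ρ))) ≤ V (ρ / (1 - τ * ρ * (V ρ' - V ρ)))
        ∧ V (ρ / (1 - τ * ρ * (V ρ' - V ρ))) ≤ V (ρ / (1 + τ * ρ * V ρ)) := by
  intro r hr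
  obtain ⟨h0, h1⟩ := hbd r hr
  have ht : 0 ≤ τ * ρ := mul_nonneg hτ hρ.le
  have e1 : 1 - τ * ρ * (V₀ - V ρ) ≤ 1 - τ * ρ * (V r - V ρ) := by
    nlinarith [mul_le_mul_of_nonneg_left h1 ht]
  have e2 : 1 - τ * ρ * (V r - V ρ) ≤ 1 + τ * ρ * V ρ := by
    nlinarith [mul_nonneg ht h0]
  have p1 : 0 < 1 - τ * ρ * (V r - V ρ) := lt_of_lt_of_le hden e1
  have p2 : 0 < 1 + τ * ρ * V ρ := lt_of_lt_of_le p1 e2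
  exact ⟨div_pos hρ p1,
    hmono _ _ (div_pos hρ p1) (div_le_div_of_nonneg_left hρ.le hden e1),
    hmono _ _ (div_pos hρ p2) (div_le_div_of_nonneg_left hρ.le p1 e2)⟩
end
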